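/- Let G = (V,E) be a finite graph that is regular of degree d ≥ 1 and whose adjacency matrix has smallest eigenvalue −λ. Set σ⁺ = (ln(d+1)+1)/(d+λ) and α = λ/(d+λ). Then there exists a function f from subsets of V to subsets of V such that for every K ⊆ V there is a set S ⊆ V with the following properties, where A := f(S): (1) |S| ≤ σ⁺·|V|, |A| ≤ α·|V|, and the maximum degree of the subgraph of G induced on A is strictly less than λ; (2) S ⊆ K ⊆ S ∪ N(S) ∪ A, where N(S) denotes the set of vertices adjacent to some vertex of S. -/

import Mathlib

open Filter Set

/-- `−λ` is the smallest eigenvalue of the adjacency matrix of `G`. -/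
def SmallestAdjEigenvalue {V : Type*} [Fintype V] [DecidableEq V]
    (G : SimpleGraph V) [DecidableRel G.Adj] (lam : ℝ) : Prop :=
  Module.End.HasEigenvalue (Matrix.toLin' (G.adjMatrix ℝ)) (-lam) ∧
    ∀ μ : ℝ, Module.End.HasEigenvalue (Matrix.toLin' (G.adjMatrix ℝ)) μ → -lam ≤ μ

/-- The neighbourhood `N(S)` of a set of vertices: all vertices adjacent to a vertex of `S`. -/
def setNbhd {V : Type*} (G : SimpleGraph V) (S : Set V) : Set V :=
  {v | ∃ s ∈ S, G.Adj s v}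

namespace KW

/-- The potential for states in which some induced degree is at least `L`. -/
noncomputable def psi (L x : ℝ) : ℝ := if 0 ≤ x then 1 + Real.log (1 + x) else 1 + x / (L + 1)

lemma log_step {x y : ℝ} (hy : 0 ≤ y) (hyx : y ≤ x) :
    Real.log (1 + y) + (x - y) / (1 + x) ≤ Real.log (1 + x) := by
  have h1 : 0 < 1 + y := by linarith
  have h2 : 0 < 1 + x := by linarith
  have h := Real.log_le_sub_one_of_pos (div_pos h1 h2)
  rw [Real.log_div h1.ne' h2.ne'] at h
  have : (1 + y) / (1 + x) - 1 = - ((x - y) / (1 + x)) := by field_simp; ring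
  linarith

lemma psi_step {L x y m : ℝ} (hL : 0 ≤ L) (hyx : y ≤ x) (hxm : x + 1 ≤ m) (hLm : L + 1 ≤ m) :
    psi L y + (x - y) / m ≤ psi L x := by
  have hm : 0 < m := by linarith
  unfold psi
  by_cases hy : 0 ≤ y
  · have hx : 0 ≤ x := hy.trans hyx
    rw [if_pos hy, if_pos hx]
    have h1 := log_step hy hyx
    have h2 : (x - y) / m ≤ (x - y) / (1 + x) :=
      div_le_div_of_nonneg_left (by linarith) (by linarith) (by linarith)
    linarith
  · rw [if_neg hy]
    push Not at hy
    by_cases hx : 0 ≤ x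
    · rw [if_pos hx]
      have h1 := log_step le_rfl hx
      have h2 : (x - 0) / m ≤ (x - 0) / (1 + x) :=
        div_le_div_of_nonneg_left (by linarith) (by linarith) (by linarith)
      have h3 : (-y) / m ≤ (-y) / (L + 1) :=
        div_le_div_of_nonneg_left (by linarith) (by linarith) (by linarith)
      have h4 : (x - y) / m = (x - 0) / m + (-y) / m := by ring
      have h5 : (-y) / (L + 1) = - (y / (L + 1)) := by ring
      simp only [add_zero, Real.log_one] at h1
      linarith
    · rw [if_neg hx]
      have h3 : (x - y) / m ≤ (x - y) / (L + 1) :=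
        div_le_div_of_nonneg_left (by linarith) (by linarith) (by linarith)
      have h5 : (x - y) / (L + 1) = x / (L + 1) - y / (L + 1) := by ring
      linarith

lemma psi_mono {L x y : ℝ} (hL : 0 ≤ L) (hyx : y ≤ x) : psi L y ≤ psi L x := by
  have h := psi_step hL hyx (le_max_left (x + 1) (L + 1)) (le_max_right _ _)
  have h2 : 0 ≤ (x - y) / max (x + 1) (L + 1) :=
    div_nonneg (by linarith) (le_trans (by linarith) (le_max_right (x + 1) (L + 1)))
  linarith

/-- The full potential; `p` says that some induced degree is at least `L`. -/
noncomputable def pot (L b : ℝ) (p : Prop) (x : ℝ) : ℝ :=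
  open Classical in if p then psi L x else if 0 < x then Real.log (1 + x) + b else 0

lemma pot_nonneg {L b x : ℝ} {p : Prop} (hL : 0 ≤ L) (hb : 0 ≤ b) (hx : -L ≤ x) :
    0 ≤ pot L b p x := by
  unfold pot psi
  split_ifs with h1 h2 h3
  · have := Real.log_nonneg (show (1 : ℝ) ≤ 1 + x by linarith); linarith
  · have : -1 ≤ x / (L + 1) := by rw [le_div_iff₀ (by linarith)]; linarith
    linarith
  · have := Real.log_nonneg (show (1 : ℝ) ≤ 1 + x by linarith); linarith
  · exact le_rfl

lemma pot_le_psi {L b x : ℝ} {p : Prop} (hL : 0 ≤ L) (hb1 : b ≤ 1) (hx : -L ≤ x) :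
    pot L b p x ≤ psi L x := by
  have h0 : pot L 0 True x = psi L x := by simp [pot]
  have h := pot_nonneg (p := True) hL (le_refl (0 : ℝ)) hx
  rw [h0] at h
  unfold pot
  split_ifs with h1 h2
  · exact le_rfl
  · unfold psi; rw [if_pos h2.le]; linarith
  · exact h

lemma pot_mono {L b x y : ℝ} {p q : Prop} (hL : 0 ≤ L) (hb : 0 ≤ b) (hb1 : b ≤ 1) (hy : -L ≤ y)
    (hyx : y ≤ x) (hqp : q → p) : pot L b q y ≤ pot L b p x := by
  by_cases hp : p
  · refine (pot_le_psi hL hb1 hy).trans ?_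
    simp only [pot, if_pos hp]
    exact psi_mono hL hyx
  · have hq : ¬ q := fun h => hp (hqp h)
    by_cases h : 0 < y
    · simp only [pot, if_neg hp, if_neg hq, if_pos h, if_pos (h.trans_le hyx)]
      have := Real.log_le_log (show 0 < 1 + y by linarith) (show 1 + y ≤ 1 + x by linarith)
      linarith
    · have : pot L b q y = 0 := by simp only [pot, if_neg hq, if_neg h]
      rw [this]; exact pot_nonneg hL hb (hy.trans hyx)

lemma pot_step {L b x y D : ℝ} {p q : Prop} (hL : 0 ≤ L) (hb : 0 ≤ b) (hb1 : b ≤ 1) (hy : -L ≤ y)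
    (hqp : q → p) (hpx : p ∨ 0 < x) (hpD : p → L ≤ D) (hxD : x ≤ D) (hD : 0 ≤ D)
    (hyx : y = x - b * (D + 1)) : pot L b q y + b ≤ pot L b p x := by
  have hD1 : (x - y) / (D + 1) = b := by rw [hyx]; field_simp; ring
  have hyx' : y ≤ x := by nlinarith
  by_cases hp : p
  · have h1 := pot_le_psi (p := q) hL hb1 hy
    have h2 := psi_step (m := D + 1) hL hyx' (by linarith) (by linarith [hpD hp])
    simp only [pot, if_pos hp] at h1 ⊢
    linarith
  · have hq : ¬ q := fun h => hp (hqp h)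
    have hx : 0 < x := hpx.resolve_left hp
    by_cases h : 0 < y
    · simp only [pot, if_neg hp, if_neg hq, if_pos h, if_pos hx]
      have h1 := log_step h.le hyx'
      have h2 : (x - y) / (D + 1) ≤ (x - y) / (1 + x) :=
        div_le_div_of_nonneg_left (by linarith) (by linarith) (by linarith)
      linarith
    · simp only [pot, if_neg hp, if_neg hq, if_neg h, if_pos hx]
      have := Real.log_nonneg (show (1 : ℝ) ≤ 1 + x by linarith); linarith

section graph
variable {V : Type*} [Fintype V] [DecidableEq V] (G : SimpleGraph V) [DecidableRel G.Adj]

lemma psd (lam : ℝ) (hlam : SmallestAdjEigenvalue G lam) (x : V → ℝ) :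
    0 ≤ ∑ i, x i * (∑ j ∈ G.neighborFinset i, x j) + lam * ∑ i, x i ^ 2 := by
  have hH : (G.adjMatrix ℝ + lam • (1 : Matrix V V ℝ)).IsHermitian := by
    apply Matrix.IsHermitian.ext
    intro i j
    simp [Matrix.one_apply, G.adj_comm i j, eq_comm]
  have hpsd : (G.adjMatrix ℝ + lam • (1 : Matrix V V ℝ)).PosSemidef := by
    rw [hH.posSemidef_iff_eigenvalues_nonneg]
    intro i
    have h1 := hH.mulVec_eigenvectorBasis i
    have h2 : Module.End.HasEigenvalue (Matrix.toLin' (G.adjMatrix ℝ))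
        (hH.eigenvalues i - lam) := by
      apply Module.End.hasEigenvalue_of_hasEigenvector (x := ⇑(hH.eigenvectorBasis i))
      rw [Module.End.hasEigenvector_iff, Module.End.mem_eigenspace_iff]
      constructor
      · rw [Matrix.toLin'_apply]
        rw [Matrix.add_mulVec, Matrix.smul_mulVec, Matrix.one_mulVec] at h1
        rw [sub_smul, ← h1]; simp
      · intro h0
        apply hH.eigenvectorBasis.orthonormal.ne_zero i
        ext j
        exact congrFun h0 j
    have := hlam.2 _ h2
    simp only [Pi.zero_apply]
    linarith
  have h := hpsd.dotProduct_mulVec_nonneg x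
  rw [Matrix.add_mulVec, Matrix.smul_mulVec, Matrix.one_mulVec, dotProduct_add] at h
  simpa [dotProduct, SimpleGraph.adjMatrix_mulVec_apply, Finset.mul_sum, pow_two,
    mul_left_comm] using h

lemma sum_nbr (d : ℕ) (hreg : G.IsRegularOfDegree d) (x : V → ℝ) :
    ∑ i, ∑ j ∈ G.neighborFinset i, x j = d * ∑ i, x i := by
  have : ∀ i, ∑ j ∈ G.neighborFinset i, x j = ∑ j, if G.Adj i j then x j else 0 := by
    intro i
    rw [← Finset.sum_filter]
    congr 1; ext; simp
  simp_rw [this]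
  rw [Finset.sum_comm, Finset.mul_sum]
  refine Finset.sum_congr rfl fun j _ => ?_
  simp_rw [G.adj_comm _ j]
  rw [← Finset.sum_filter, Finset.sum_const, nsmul_eq_mul]
  congr 2
  rw [← hreg j, ← G.card_neighborFinset_eq_degree]
  congr 1; ext; simp

/-- number of neighbours of `v` inside `A` -/
def dg (A : Finset V) (v : V) : ℕ := (A.filter (fun w => G.Adj v w)).card

lemma mixing (d : ℕ) (hreg : G.IsRegularOfDegree d) (lam : ℝ) (hlam : SmallestAdjEigenvalue G lam)
    (A : Finset V) (hA : A.Nonempty) :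
    (d + lam) / Fintype.card V * A.card * A.card - lam * A.card ≤ ∑ v ∈ A, (dg G A v : ℝ) := by
  have hn : (0 : ℝ) < Fintype.card V := by
    have : Nonempty V := hA.to_type
    exact_mod_cast Fintype.card_pos
  set n : ℝ := (Fintype.card V : ℝ) with hnn
  set s : ℝ := (A.card : ℝ) with hs
  set c : ℝ := s / n with hc
  have hcn : c * n = s := by rw [hc]; field_simp
  let u : V → ℝ := fun i => if i ∈ A then 1 else 0
  have hu : ∑ i, u i = s := by simp [u, hs]
  have hu2 : ∑ i, u i ^ 2 = s := by simp [u, hs]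
  have hdg : ∀ i, ∑ j ∈ G.neighborFinset i, u j = dg G A i := by
    intro i
    simp only [u, Finset.sum_boole, dg]
    congr 2; ext; simp [and_comm]
  have hdgs : ∑ i, (dg G A i : ℝ) = d * s := by
    rw [← hu, ← sum_nbr G d hreg]; simp [hdg]
  have hdeg : ∀ i, ∑ j ∈ G.neighborFinset i, (u j - c) = dg G A i - d * c := by
    intro i
    rw [Finset.sum_sub_distrib, hdg, Finset.sum_const, G.card_neighborFinset_eq_degree, hreg i,
      nsmul_eq_mul]
  have h := psd G lam hlam (fun i => u i - c)
  simp only [hdeg] at h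
  have e1 : ∑ i, (u i - c) * (dg G A i - d * c) =
      ∑ v ∈ A, (dg G A v : ℝ) - d * c * s - c * (d * s) + n * (c * (d * c)) := by
    have : ∀ i, (u i - c) * (dg G A i - d * c) =
      u i * dg G A i - d * c * u i - c * dg G A i + c * (d * c) := by intro i; ring
    simp_rw [this]
    rw [Finset.sum_add_distrib, Finset.sum_sub_distrib, Finset.sum_sub_distrib, ← Finset.mul_sum,
      ← Finset.mul_sum, hu, hdgs]
    simp [u, hnn]
  have e2 : ∑ i, (u i - c) ^ 2 = s - 2 * c * s + n * c ^ 2 := by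
    have : ∀ i, (u i - c) ^ 2 = u i ^ 2 - 2 * c * u i + c ^ 2 := by intro i; ring
    simp_rw [this]
    rw [Finset.sum_add_distrib, Finset.sum_sub_distrib, ← Finset.mul_sum, hu, hu2]
    simp [hnn]
  rw [e1, e2] at h
  have e3 : (d + lam) / n * s * s = (d + lam) * (c * s) := by rw [hc]; field_simp
  have e4 : n * (c * (d * c)) = d * (c * s) := by rw [← hcn]; ring
  have e5 : n * c ^ 2 = c * s := by rw [← hcn]; ring
  rw [e4, e5] at h
  rw [e3]
  nlinarith

lemma lam_nonneg [Nonempty V] (lam : ℝ) (hlam : SmallestAdjEigenvalue G lam) : 0 ≤ lam := by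
  obtain ⟨v⟩ := ‹Nonempty V›
  have h := psd G lam hlam (fun i => if i = v then 1 else 0)
  have e : ∑ i, (if i = v then (1 : ℝ) else 0) *
      (∑ j ∈ G.neighborFinset i, if j = v then (1 : ℝ) else 0) = 0 := by
    refine Finset.sum_eq_zero fun i _ => ?_
    by_cases hi : i = v
    · subst hi; simp
    · simp [hi]
  rw [e] at h
  simpa using h

lemma lam_le (d : ℕ) (hd : 1 ≤ d) [Nonempty V] (hreg : G.IsRegularOfDegree d) (lam : ℝ)
    (hlam : SmallestAdjEigenvalue G lam) : d + lam ≤ Fintype.card V := by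
  have h0 := lam_nonneg G lam hlam
  obtain ⟨x, hx⟩ := hlam.1.exists_hasEigenvector
  rw [Module.End.hasEigenvector_iff, Module.End.mem_eigenspace_iff, Matrix.toLin'_apply] at hx
  obtain ⟨hx, hx0⟩ := hx
  have hxi : ∀ i, ∑ j ∈ G.neighborFinset i, x j = -lam * x i := by
    intro i
    have := congrFun hx i
    rwa [SimpleGraph.adjMatrix_mulVec_apply] at this
  have hsum : ∑ i, x i = 0 := by
    have h := sum_nbr G d hreg x
    simp_rw [hxi] at h
    rw [← Finset.mul_sum] at h
    have hd' : (1 : ℝ) ≤ d := by exact_mod_cast hd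
    have : (d + lam) * ∑ i, x i = 0 := by linarith
    rcases mul_eq_zero.mp this with h | h
    · linarith
    · exact h
  obtain ⟨i, hi⟩ := Finite.exists_max (fun i => |x i|)
  have hipos : 0 < |x i| := by
    obtain ⟨j, hj⟩ := Function.ne_iff.mp hx0
    exact (abs_pos.mpr hj).trans_le (hi j)
  have hc : ∑ j ∈ (G.neighborFinset i)ᶜ, x j = lam * x i := by
    have := Finset.sum_add_sum_compl (G.neighborFinset i) x
    rw [hxi, hsum] at this
    linarith
  have hcard : ((G.neighborFinset i)ᶜ.card : ℝ) = Fintype.card V - d := by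
    rw [Finset.card_compl, G.card_neighborFinset_eq_degree, hreg i, Nat.cast_sub]
    rw [← hreg i]; exact (G.degree_lt_card_verts i).le
  have hle : lam * |x i| ≤ (Fintype.card V - d) * |x i| := by
    calc lam * |x i| = |∑ j ∈ (G.neighborFinset i)ᶜ, x j| := by
          rw [hc, abs_mul, abs_of_nonneg h0]
      _ ≤ ∑ j ∈ (G.neighborFinset i)ᶜ, |x j| := Finset.abs_sum_le_sum_abs _ _
      _ ≤ ∑ j ∈ (G.neighborFinset i)ᶜ, |x i| := Finset.sum_le_sum fun j _ => hi j
      _ = _ := by rw [Finset.sum_const, nsmul_eq_mul, hcard]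
  have := le_of_mul_le_mul_right hle hipos
  linarith

/-- Some vertex of `A` has at least `lam` neighbours in `A`. -/
def big (lam : ℝ) (A : Finset V) : Prop := ∃ v ∈ A, lam ≤ dg G A v

lemma dg_mono {A B : Finset V} (h : B ⊆ A) (v : V) : dg G B v ≤ dg G A v :=
  Finset.card_le_card (Finset.filter_subset_filter _ h)

lemma big_mono {lam : ℝ} {A B : Finset V} (h : B ⊆ A) : big G lam B → big G lam A := by
  rintro ⟨v, hv, hl⟩
  exact ⟨v, h hv, hl.trans (by exact_mod_cast dg_mono G h v)⟩

lemma main_ind (d : ℕ) (hreg : G.IsRegularOfDegree d) (lam b : ℝ) (h0 : 0 ≤ lam)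
    (hlam : SmallestAdjEigenvalue G lam) (hb : b = (d + lam) / Fintype.card V) (hb0 : 0 ≤ b)
    (hb1 : b ≤ 1) (k : ℕ) : ∀ A : Finset V, A.card = k →
    ∃ f : Finset V → Finset V, ∀ K : Finset V, ∃ S : Finset V, S ⊆ K ∧ S ⊆ A ∧
      b * S.card ≤ pot lam b (big G lam A) (b * A.card - lam) ∧
      b * (f S).card ≤ lam ∧ ¬ big G lam (f S) ∧
      ∀ w ∈ K, w ∈ A → w ∈ S ∨ (∃ s ∈ S, G.Adj s w) ∨ w ∈ f S := by
  induction k using Nat.strong_induction_on with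
  | _ k ih =>
  intro A hAk
  have hxge : ∀ B : Finset V, -lam ≤ b * B.card - lam := by
    intro B
    have : 0 ≤ b * (B.card : ℝ) := by positivity
    linarith
  by_cases hgood : ¬ big G lam A ∧ b * A.card ≤ lam
  · refine ⟨fun _ => A, fun K => ⟨∅, by simp, by simp, ?_, hgood.2, hgood.1, ?_⟩⟩
    · simpa using pot_nonneg h0 hb0 (hxge A)
    · intro w _ hw; exact Or.inr (Or.inr hw)
  have hpx : big G lam A ∨ 0 < b * A.card - lam := by
    by_contra h
    push Not at h
    exact hgood ⟨h.1, by linarith [h.2]⟩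
  have hne : A.Nonempty := by
    rw [Finset.nonempty_iff_ne_empty]
    rintro rfl
    rcases hpx with ⟨v, hv, _⟩ | h
    · simp at hv
    · simp at h; linarith
  obtain ⟨v, hvA, hvmax⟩ := Finset.exists_max_image A (dg G A) hne
  have hbD : big G lam A → lam ≤ dg G A v := by
    rintro ⟨w, hw, hl⟩
    exact hl.trans (by exact_mod_cast hvmax w hw)
  have hxD : b * A.card - lam ≤ dg G A v := by
    have h1 := mixing G d hreg lam hlam A hne
    rw [← hb] at h1
    have h2 : ∑ w ∈ A, (dg G A w : ℝ) ≤ A.card * dg G A v := by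
      rw [← nsmul_eq_mul, ← Finset.sum_const]
      exact Finset.sum_le_sum fun w hw => by exact_mod_cast hvmax w hw
    have h3 : (0 : ℝ) < A.card := by exact_mod_cast hne.card_pos
    have h4 : (b * A.card - lam) * A.card ≤ dg G A v * A.card := by nlinarith
    exact le_of_mul_le_mul_right h4 h3
  set A1 := A.erase v with hA1
  set A2 := A1.filter (fun w => ¬ G.Adj v w) with hA2
  have hA1A : A1 ⊆ A := Finset.erase_subset _ _
  have hA2A : A2 ⊆ A := (Finset.filter_subset _ _).trans hA1A
  have hc1 : A1.card < k := by rw [← hAk]; exact Finset.card_erase_lt_of_mem hvA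
  have hc2 : A2.card < k := (Finset.card_le_card (Finset.filter_subset _ _)).trans_lt hc1
  have hcard2 : (A2.card : ℝ) = A.card - (dg G A v + 1) := by
    have h1 := Finset.card_filter_add_card_filter_not (s := A1) (fun w => G.Adj v w)
    have h2 : A1.filter (fun w => G.Adj v w) = A.filter (fun w => G.Adj v w) := by
      ext w
      simp only [hA1, Finset.mem_filter, Finset.mem_erase]
      constructor
      · rintro ⟨⟨_, h⟩, h'⟩; exact ⟨h, h'⟩
      · rintro ⟨h, h'⟩; exact ⟨⟨h'.ne', h⟩, h'⟩
    have h3 : A1.card + 1 = A.card := Finset.card_erase_add_one hvA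
    rw [h2] at h1
    have h4 : dg G A v + A2.card + 1 = A.card := by rw [← h3, ← h1]; rfl
    have h5 : (dg G A v + A2.card + 1 : ℝ) = A.card := by exact_mod_cast h4
    linarith
  obtain ⟨f1, hf1⟩ := ih _ hc1 A1 rfl
  obtain ⟨f2, hf2⟩ := ih _ hc2 A2 rfl
  refine ⟨fun T => if v ∈ T then f2 (T.erase v) else f1 T, fun K => ?_⟩
  by_cases hvK : v ∈ K
  · obtain ⟨S, hSK, hSA, hSc, hfc, hfb, hcov⟩ := hf2 K
    have hvS : v ∉ S := fun h => by
      have := hSA h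
      simp [hA2, hA1] at this
    refine ⟨insert v S, ?_, ?_, ?_, ?_, ?_, ?_⟩
    · exact Finset.insert_subset hvK hSK
    · exact Finset.insert_subset hvA (hSA.trans hA2A)
    · rw [Finset.card_insert_of_notMem hvS]
      have := pot_step (b := b) (D := dg G A v) (q := big G lam A2) h0 hb0 hb1 (hxge A2)
        (big_mono G hA2A) hpx hbD hxD (by positivity) (by rw [hcard2]; ring)
      push_cast
      linarith
    · simpa [hvS] using hfc
    · simpa [hvS] using hfb
    · intro w hwK hwA
      simp only [Finset.mem_insert_self, if_true, Finset.erase_insert hvS]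
      by_cases hwv : w = v
      · left; simp [hwv]
      by_cases hadj : G.Adj v w
      · right; left; exact ⟨v, by simp, hadj⟩
      rcases hcov w hwK (by simp [hA2, hA1, hwv, hwA, hadj]) with h | ⟨s, hs, h⟩ | h
      · left; simp [h]
      · right; left; exact ⟨s, by simp [hs], h⟩
      · right; right; exact h
  · obtain ⟨S, hSK, hSA, hSc, hfc, hfb, hcov⟩ := hf1 K
    have hvS : v ∉ S := fun h => hvK (hSK h)
    refine ⟨S, hSK, hSA.trans hA1A, ?_, ?_, ?_, ?_⟩
    · refine hSc.trans (pot_mono h0 hb0 hb1 (hxge A1) ?_ (big_mono G hA1A))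
      have : (A1.card : ℝ) ≤ A.card := by exact_mod_cast Finset.card_le_card hA1A
      nlinarith
    · simpa [hvS] using hfc
    · simpa [hvS] using hfb
    · intro w hwK hwA
      simp only [if_neg hvS]
      refine hcov w hwK ?_
      simp only [hA1, Finset.mem_erase]
      exact ⟨fun h => hvK (h ▸ hwK), hwA⟩

end graph
end KW

/-- For a `d`-regular graph `G` (`d ≥ 1`) with smallest adjacency eigenvalue
`−λ`, there is a function `f` on subsets of `V` such that for each `K ⊆ V` there is `S ⊆ V`
with (writing `A := f S`): `|S| ≤ σ⁺|V|`, `|A| ≤ α|V|`, the maximum degree of the subgraph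
induced on `A` is `< λ`, and `S ⊆ K ⊆ S ∪ N(S) ∪ A`, where `σ⁺ = (ln(d+1)+1)/(d+λ)` and
`α = λ/(d+λ)`. -/
theorem kleitman_winston_container {V : Type*} [Fintype V] [DecidableEq V]
    (G : SimpleGraph V) [DecidableRel G.Adj] (d : ℕ) (hd : 1 ≤ d)
    (hreg : G.IsRegularOfDegree d) (lam : ℝ) (hlam : SmallestAdjEigenvalue G lam) :
    ∃ f : Set V → Set V, ∀ K : Set V, ∃ S : Set V,
      ((S.ncard : ℝ) ≤ (Real.log (d + 1) + 1) / (d + lam) * Fintype.card V ∧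
        ((f S).ncard : ℝ) ≤ lam / (d + lam) * Fintype.card V ∧
        (∀ v ∈ f S, (((f S) ∩ {w | G.Adj v w}).ncard : ℝ) < lam)) ∧
      S ⊆ K ∧ K ⊆ S ∪ setNbhd G S ∪ f S := by
  classical
  have hV : Nonempty V := by
    obtain ⟨x, hx⟩ := hlam.1.exists_hasEigenvector
    obtain ⟨j, -⟩ := Function.ne_iff.mp hx.2
    exact ⟨j⟩
  have h0 := KW.lam_nonneg G lam hlam
  have hle := KW.lam_le G d hd hreg lam hlam
  have hd' : (1 : ℝ) ≤ d := by exact_mod_cast hd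
  have hn : (0 : ℝ) < Fintype.card V := by linarith
  have hdl : 0 < d + lam := by linarith
  obtain ⟨b, hb⟩ : ∃ b : ℝ, b = (d + lam) / Fintype.card V := ⟨_, rfl⟩
  have hbpos : 0 < b := by rw [hb]; positivity
  have hb1 : b ≤ 1 := by rw [hb, div_le_one hn]; exact hle
  have hconv : ∀ t s : ℝ, b * s ≤ t → s ≤ t / (d + lam) * Fintype.card V := by
    intro t s h
    have e : t / (d + lam) * Fintype.card V = t / b := by rw [hb]; field_simp
    rw [e, le_div_iff₀ hbpos]; linarith
  obtain ⟨f, hf⟩ := KW.main_ind G d hreg lam b h0 hlam hb hbpos.le hb1 _ Finset.univ rfl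
  refine ⟨fun T => ↑(f T.toFinset), fun K => ?_⟩
  obtain ⟨S, hSK, -, hSc, hfc, hfb, hcov⟩ := hf K.toFinset
  have hx : b * (Finset.univ : Finset V).card - lam = d := by
    rw [Finset.card_univ, hb]; field_simp; ring
  rw [hx] at hSc
  have hSc' := hSc.trans (KW.pot_le_psi h0 hb1 (by linarith))
  rw [KW.psi, if_pos (by linarith)] at hSc'
  refine ⟨↑S, ⟨?_, ?_, ?_⟩, ?_, ?_⟩
  · rw [Set.ncard_coe_finset]
    apply hconv
    rw [add_comm (d : ℝ) 1]
    linarith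
  · simp only [Finset.toFinset_coe, Set.ncard_coe_finset]
    exact hconv _ _ hfc
  · intro v hv
    simp only [Finset.toFinset_coe] at hv ⊢
    by_contra hcon
    push Not at hcon
    refine hfb ⟨v, hv, hcon.trans (le_of_eq ?_)⟩
    rw [KW.dg, ← Set.ncard_coe_finset]
    congr 2
    ext w
    simp
  · intro w hw
    simpa using hSK hw
  · intro w hw
    simp only [Finset.toFinset_coe]
    rcases hcov w (by simpa using hw) (Finset.mem_univ w) with h | h | h
    · left; left; exact h
    · left; right; exact h
    · right; exact h
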